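/- arXiv:2210.04442 — 5 statements merged into one kernel-verified Lean document; each statement's English description precedes it below -/
import Mathlib

section
/- Let σ > 0, τ ∈ ℝ, and q ≥ 0, and let φ_μ denote the Gaussian probability density with mean μ and variance σ². Then ∫ z in ℝ, (φ_τ(z))² / (φ_0(z) + q * φ_τ(z)) dz ≤ exp(τ² / σ²). -/
open MeasureTheory Real

theorem gaussian_ratio_mixture_bound
    (σ τ q : ℝ) (hσ : 0 < σ) (hq : 0 ≤ q)
    (φ : ℝ → ℝ → ℝ)
    (hφ : ∀ μ z, φ μ z =
      (Real.sqrt (2 * Real.pi * σ ^ 2))⁻¹ * Real.exp (-(z - μ) ^ 2 / (2 * σ ^ 2))) :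
    ∫ z : ℝ, (φ τ z) ^ 2 / (φ 0 z + q * φ τ z) ≤ Real.exp (τ ^ 2 / σ ^ 2) := by
  have hpos : ∀ μ z, 0 < φ μ z := by
    intro μ z
    rw [hφ]
    positivity
  have hv : (⟨σ ^ 2, by positivity⟩ : NNReal) ≠ 0 := by
    intro h
    have h2 := congrArg NNReal.toReal h
    have h3 : σ ^ 2 = 0 := h2
    exact (pow_pos hσ 2).ne' h3
  have hg : ∀ μ, φ μ = ProbabilityTheory.gaussianPDFReal μ ⟨σ ^ 2, by positivity⟩ := by
    intro μ
    funext z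
    rw [hφ]
    rfl
  have hint : Integrable (φ (2 * τ)) := by
    rw [hg]
    exact ProbabilityTheory.integrable_gaussianPDFReal _ _
  have hone : ∫ z, φ (2 * τ) z = 1 := by
    rw [hg]
    exact ProbabilityTheory.integral_gaussianPDFReal_eq_one _ hv
  have hid : ∀ z, (φ τ z) ^ 2 = Real.exp (τ ^ 2 / σ ^ 2) * φ (2 * τ) z * φ 0 z := by
    intro z
    have he : Real.exp (-(z - τ) ^ 2 / (2 * σ ^ 2)) ^ 2 = Real.exp (τ ^ 2 / σ ^ 2) *
        Real.exp (-(z - 2 * τ) ^ 2 / (2 * σ ^ 2)) * Real.exp (-(z - 0) ^ 2 / (2 * σ ^ 2)) := by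
      rw [← Real.exp_nat_mul, ← Real.exp_add, ← Real.exp_add]
      congr 1
      push_cast
      field_simp
      ring
    rw [hφ, hφ, hφ, mul_pow, he]
    ring
  calc ∫ z : ℝ, (φ τ z) ^ 2 / (φ 0 z + q * φ τ z)
      ≤ ∫ z : ℝ, Real.exp (τ ^ 2 / σ ^ 2) * φ (2 * τ) z := by
        apply integral_mono_of_nonneg
        · refine Filter.Eventually.of_forall fun z => ?_
          have h0 := hpos 0 z
          have h1 := hpos τ z
          show 0 ≤ (φ τ z) ^ 2 / (φ 0 z + q * φ τ z)
          positivity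
        · exact hint.const_mul _
        · refine Filter.Eventually.of_forall fun z => ?_
          have h0 := hpos 0 z
          have h1 := hpos τ z
          have h2 := hpos (2 * τ) z
          show (φ τ z) ^ 2 / (φ 0 z + q * φ τ z) ≤ Real.exp (τ ^ 2 / σ ^ 2) * φ (2 * τ) z
          rw [div_le_iff₀ (by positivity), hid z]
          apply mul_le_mul_of_nonneg_left _ (by positivity)
          have : 0 ≤ q * φ τ z := by positivity
          linarith
    _ = Real.exp (τ ^ 2 / σ ^ 2) := by
        rw [integral_const_mul, hone, mul_one]
end

section
/- Let E be a real normed vector space, M, N positive natural numbers, τ ≥ 0, and Π : Matrix (Fin M) (Fin N) ℝ a matrix whose every column has ℓ1 norm at most τ, i.e., for every i, ∑ j, |Π j i| ≤ τ. Let f, f' : Fin N → E be two families of vectors that agree at every index except possibly at one index i₀, where ‖f i₀ − f' i₀‖ ≤ B for some B ≥ 0. Then ‖(∑ j, ∑ k, Π j k • f k) − (∑ j, ∑ k, Π j k • f' k)‖ ≤ τ * B. -/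
open Finset

theorem appr_aggregation_sensitivity
    {E : Type*} [NormedAddCommGroup E] [NormedSpace ℝ E]
    (M N : ℕ) (hM : 0 < M) (hN : 0 < N)
    (τ B : ℝ) (hτ : 0 ≤ τ) (hB : 0 ≤ B)
    (Pr : Matrix (Fin M) (Fin N) ℝ)
    (hPr : ∀ i : Fin N, ∑ j : Fin M, |Pr j i| ≤ τ)
    (f f' : Fin N → E) (i₀ : Fin N)
    (hagree : ∀ k : Fin N, k ≠ i₀ → f k = f' k)
    (hi₀ : ‖f i₀ - f' i₀‖ ≤ B) :
    ‖(∑ j : Fin M, ∑ k : Fin N, Pr j k • f k) -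
      (∑ j : Fin M, ∑ k : Fin N, Pr j k • f' k)‖ ≤ τ * B := by
  have h : (∑ j : Fin M, ∑ k : Fin N, Pr j k • f k) -
      (∑ j : Fin M, ∑ k : Fin N, Pr j k • f' k) = (∑ j : Fin M, Pr j i₀) • (f i₀ - f' i₀) := by
    rw [← Finset.sum_sub_distrib, Finset.sum_smul]
    refine Finset.sum_congr rfl fun j _ => ?_
    rw [← Finset.sum_sub_distrib, Finset.sum_eq_single i₀]
    · rw [smul_sub]
    · intro k _ hk
      rw [hagree k hk, sub_self]
    · intro hk
      exact absurd (Finset.mem_univ _) hk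
  rw [h, norm_smul, Real.norm_eq_abs]
  exact mul_le_mul ((Finset.abs_sum_le_sum_abs _ _).trans (hPr i₀)) hi₀ (norm_nonneg _) hτ
end

section
/- Let β > 0 and n a positive natural number, let u : Fin n → ℝ, and let γ_β be the Gumbel probability measure on ℝ with scale β, defined as volume.withDensity (fun x => β⁻¹ * exp(−x/β − exp(−x/β))). Let P = Measure.pi (fun _ : Fin n => γ_β) be the law of n i.i.d. Gumbel(β) random variables. Then for every index j : Fin n, P {g : Fin n → ℝ | ∀ i ≠ j, u j + g j > u i + g i} = exp(u j / β) / (∑ i, exp(u i / β)). -/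
open MeasureTheory Real

open Filter Topology in
theorem gm_Iic (F f : ℝ → ℝ) (hf : Continuous f) (h0 : ∀ x, 0 ≤ f x)
    (hd : ∀ x, HasDerivAt F (f x) x) (hb : Tendsto F atBot (𝓝 0)) (a : ℝ) :
    ∫⁻ x in Set.Iic a, ENNReal.ofReal (f x) = ENNReal.ofReal (F a) := by
  have hc : AECover ((volume : Measure ℝ).restrict (Set.Iic a)) atBot (fun i : ℝ => Set.Ioi i) :=
    aecover_Ioi tendsto_id
  refine hc.lintegral_eq_of_tendsto _ (by fun_prop) ?_
  have h1 : Tendsto (fun i => ENNReal.ofReal (F a - F i)) atBot (𝓝 (ENNReal.ofReal (F a))) := by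
    have := (hb.const_sub (F a))
    rw [sub_zero] at this
    exact (ENNReal.continuous_ofReal.tendsto _).comp this
  refine h1.congr' ?_
  filter_upwards [Iic_mem_atBot a] with i hi
  rw [Measure.restrict_restrict measurableSet_Ioi, Set.Ioi_inter_Iic,
    ← ofReal_integral_eq_lintegral_ofReal, ← intervalIntegral.integral_of_le hi,
    intervalIntegral.integral_eq_sub_of_hasDerivAt (fun x _ => hd x)
      (hf.intervalIntegrable _ _)]
  · exact (hf.intervalIntegrable i a).1
  · exact Eventually.of_forall h0

open Filter Topology in
theorem gm_univ (F f : ℝ → ℝ) (hf : Continuous f) (h0 : ∀ x, 0 ≤ f x)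
    (hd : ∀ x, HasDerivAt F (f x) x) (hb : Tendsto F atBot (𝓝 0)) (m : ℝ)
    (ht : Tendsto F atTop (𝓝 m)) :
    ∫⁻ x, ENNReal.ofReal (f x) = ENNReal.ofReal m := by
  have hc : AECover (volume : Measure ℝ) atTop (fun i : ℝ => Set.Iic i) :=
    aecover_Iic tendsto_id
  refine hc.lintegral_eq_of_tendsto _ (by fun_prop) ?_
  simp_rw [gm_Iic F f hf h0 hd hb]
  exact (ENNReal.continuous_ofReal.tendsto _).comp ht

theorem gm_deriv (β : ℝ) (c : ℝ) (hc : 0 < c) (x : ℝ) :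
    HasDerivAt (fun x => Real.exp (-(c * Real.exp (-x / β))) / c)
      (β⁻¹ * Real.exp (-x / β - c * Real.exp (-x / β))) x := by
  have h1 : HasDerivAt (fun x : ℝ => -x / β) (-1 / β) x := (hasDerivAt_id x).neg.div_const β
  have h2 := (((h1.exp.const_mul c).neg).exp).div_const c
  refine HasDerivAt.congr_deriv h2 ?_
  simp only [Pi.neg_apply]
  rw [sub_eq_add_neg, Real.exp_add]
  field_simp

open Filter Topology in
theorem gm_bot (β : ℝ) (hβ : 0 < β) (c : ℝ) (hc : 0 < c) :
    Tendsto (fun x => Real.exp (-(c * Real.exp (-x / β))) / c) atBot (𝓝 0) := by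
  have h1 : Tendsto (fun x : ℝ => -x / β) atBot atTop :=
    tendsto_neg_atBot_atTop.atTop_div_const hβ
  have h2 := (Real.tendsto_exp_atTop.comp h1).const_mul_atTop hc
  have h3 := (Real.tendsto_exp_neg_atTop_nhds_zero.comp h2).div_const c
  simpa [Function.comp_def] using h3

open Filter Topology in
theorem gm_top (β : ℝ) (hβ : 0 < β) (c : ℝ) :
    Tendsto (fun x => Real.exp (-(c * Real.exp (-x / β))) / c) atTop (𝓝 (1 / c)) := by
  have h1 : Tendsto (fun x : ℝ => -x / β) atTop atBot :=
    tendsto_neg_atTop_atBot.atBot_div_const hβ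
  have h2 := ((Real.tendsto_exp_atBot.comp h1).const_mul c).neg
  have h3 := ((Real.continuous_exp.tendsto _).comp h2).div_const c
  simpa [Function.comp_def] using h3

theorem gumbel_max_softmax
    (β : ℝ) (hβ : 0 < β) (n : ℕ) (hn : 0 < n) (u : Fin n → ℝ)
    (γ : Measure ℝ)
    (hγ : γ = volume.withDensity
      (fun x => ENNReal.ofReal (β⁻¹ * Real.exp (-x / β - Real.exp (-x / β)))))
    (P : Measure (Fin n → ℝ)) (hP : P = Measure.pi (fun _ => γ))
    (j : Fin n) :
    P {g : Fin n → ℝ | ∀ i, i ≠ j → u j + g j > u i + g i} =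
      ENNReal.ofReal (Real.exp (u j / β) / ∑ i, Real.exp (u i / β)) := by
  obtain ⟨m, rfl⟩ : ∃ m, n = m + 1 := ⟨n - 1, by omega⟩
  have hγs : SigmaFinite γ := by
    rw [hγ]; exact SigmaFinite.withDensity_ofReal _
  have hIio : ∀ a, γ (Set.Iio a) = ENNReal.ofReal (Real.exp (-Real.exp (-a / β))) := by
    intro a
    rw [hγ, withDensity_apply _ measurableSet_Iio, setLIntegral_congr Iio_ae_eq_Iic]
    have := gm_Iic _ _ (by fun_prop) (fun x => by positivity) (gm_deriv β 1 one_pos)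
      (gm_bot β hβ 1 one_pos) a
    simpa using this
  set S : Set (Fin (m+1) → ℝ) := {g | ∀ i, i ≠ j → u j + g j > u i + g i} with hS
  set T : Set (ℝ × (Fin m → ℝ)) :=
    {p | ∀ i, p.2 i < u j + p.1 - u (j.succAbove i)} with hT
  have hTm : MeasurableSet T := by
    rw [hT, Set.setOf_forall]
    exact MeasurableSet.iInter fun i => measurableSet_lt (by fun_prop) (by fun_prop)
  have hST : S = (MeasurableEquiv.piFinSuccAbove (fun _ => ℝ) j) ⁻¹' T := by
    ext g
    simp only [hS, hT, Set.mem_setOf_eq, Set.mem_preimage]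
    rw [j.forall_iff_succAbove]
    simp only [ne_eq, not_true_eq_false, false_imp_iff, true_and, Fin.succAbove_ne,
      not_false_eq_true, true_imp_iff]
    refine forall_congr' fun i => ?_
    change _ ↔ g (j.succAbove i) < u j + g j - u (j.succAbove i)
    constructor <;> intro h <;> linarith
  have hmp := measurePreserving_piFinSuccAbove (fun _ : Fin (m+1) => γ) j
  rw [hP, hST, hmp.measure_preimage hTm.nullMeasurableSet, Measure.prod_apply hTm]
  have hsec : ∀ x : ℝ, (Measure.pi fun _ : Fin m => γ) (Prod.mk x ⁻¹' T) =
      ENNReal.ofReal (Real.exp (-((∑ i : Fin m,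
        Real.exp ((u (j.succAbove i) - u j) / β)) * Real.exp (-x / β)))) := by
    intro x
    have : Prod.mk x ⁻¹' T = Set.univ.pi fun i => Set.Iio (u j + x - u (j.succAbove i)) := by
      ext g; simp [hT]
    rw [this, Measure.pi_pi]
    simp_rw [hIio]
    rw [← ENNReal.ofReal_prod_of_nonneg (fun _ _ => (Real.exp_pos _).le), ← Real.exp_sum,
      Finset.sum_neg_distrib, Finset.sum_mul]
    congr 3
    refine Finset.sum_congr rfl fun i _ => ?_
    rw [← Real.exp_add]
    congr 1
    ring
  simp_rw [hsec]
  set s := ∑ i : Fin m, Real.exp ((u (j.succAbove i) - u j) / β) with hs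
  have hs0 : 0 ≤ s := Finset.sum_nonneg fun _ _ => (Real.exp_pos _).le
  have hc : 0 < 1 + s := by positivity
  rw [hγ, lintegral_withDensity_eq_lintegral_mul _ (by fun_prop) (by fun_prop)]
  have key := gm_univ _ _ (by fun_prop) (fun x => by positivity) (gm_deriv β (1 + s) hc)
      (gm_bot β hβ (1 + s) hc) _ (gm_top β hβ (1 + s))
  convert key using 1
  · refine lintegral_congr fun x => ?_
    rw [Pi.mul_apply, ← ENNReal.ofReal_mul (by positivity), mul_assoc, ← Real.exp_add]
    congr 3
    ring
  · congr 1
    rw [Fin.sum_univ_succAbove _ j]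
    have : ∑ i : Fin m, Real.exp (u (j.succAbove i) / β) = Real.exp (u j / β) * s := by
      rw [hs, Finset.mul_sum]
      refine Finset.sum_congr rfl fun i _ => ?_
      rw [← Real.exp_add]
      congr 1
      ring
    rw [this]
    have := Real.exp_pos (u j / β)
    field_simp
end

section
/- Let n be a positive natural number, β > 0, Δ ≥ 0, and let u, u' : Fin n → ℝ satisfy |u i − u' i| ≤ Δ for every i. Then for every index j : Fin n, exp(u j / β) / (∑ i, exp(u i / β)) ≤ exp(2Δ/β) * (exp(u' j / β) / (∑ i, exp(u' i / β))). In particular, taking β = Δ/ε for ε > 0, the softmax selection probabilities of j under u and u' differ by a multiplicative factor of at most exp(2ε). -/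
open Finset Real

theorem exponential_mechanism_softmax_stability
    (n : ℕ) (hn : 0 < n) (β Δ : ℝ) (hβ : 0 < β) (hΔ : 0 ≤ Δ)
    (u u' : Fin n → ℝ) (hu : ∀ i, |u i - u' i| ≤ Δ) (j : Fin n) :
    Real.exp (u j / β) / (∑ i, Real.exp (u i / β)) ≤
      Real.exp (2 * Δ / β) *
        (Real.exp (u' j / β) / (∑ i, Real.exp (u' i / β))) := by
  have hpos : ∀ v : Fin n → ℝ, 0 < ∑ i, Real.exp (v i / β) := fun v =>
    Finset.sum_pos (fun i _ => Real.exp_pos _) ⟨j, Finset.mem_univ j⟩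
  have key : ∀ a b : ℝ, a - b ≤ Δ →
      Real.exp (a / β) ≤ Real.exp (Δ / β) * Real.exp (b / β) := by
    intro a b h
    rw [← Real.exp_add, ← add_div]
    apply Real.exp_le_exp.mpr
    exact div_le_div_of_nonneg_right (by linarith) hβ.le
  have h1 := key (u j) (u' j) (abs_le.mp (hu j)).2
  have h2 : ∑ i, Real.exp (u' i / β) ≤ Real.exp (Δ / β) * ∑ i, Real.exp (u i / β) := by
    rw [Finset.mul_sum]
    refine Finset.sum_le_sum fun i _ => key _ _ ?_
    linarith [(abs_le.mp (hu i)).1]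
  have h3 : Real.exp (2 * Δ / β) = Real.exp (Δ / β) * Real.exp (Δ / β) := by
    rw [← Real.exp_add]
    congr 1
    ring
  rw [h3, ← mul_div_assoc, div_le_div_iff₀ (hpos u) (hpos u')]
  calc Real.exp (u j / β) * ∑ i, Real.exp (u' i / β)
      ≤ (Real.exp (Δ / β) * Real.exp (u' j / β)) *
          (Real.exp (Δ / β) * ∑ i, Real.exp (u i / β)) :=
        mul_le_mul h1 h2 (hpos u').le (by positivity)
    _ = _ := by ring
end

section
/- Let σ > 0, λ ∈ ℝ, n a positive natural number, and x, y : Fin n → ℝ. Let p_x(z) = ∏ i, φ_{x i}(z i) and p_y(z) = ∏ i, φ_{y i}(z i) be the product Gaussian densities on Fin n → ℝ, where φ_μ(t) = (sqrt(2π σ²))⁻¹ * exp(−(t − μ)²/(2σ²)), and let P_x = Measure.pi (fun i => gaussianReal (x i) σ²). Then ∫ z, (p_y(z) / p_x(z))^λ ∂P_x = exp(λ * (λ − 1) * (∑ i, (x i − y i)²) / (2σ²)). -/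
open MeasureTheory ProbabilityTheory Real

theorem product_gaussian_ratio_lambda_moment
    (σ lam : ℝ) (hσ : 0 < σ) (n : ℕ) (hn : 0 < n) (x y : Fin n → ℝ)
    (φ : ℝ → ℝ → ℝ)
    (hφ : ∀ μ t, φ μ t =
      (Real.sqrt (2 * Real.pi * σ ^ 2))⁻¹ * Real.exp (-(t - μ) ^ 2 / (2 * σ ^ 2)))
    (px py : (Fin n → ℝ) → ℝ)
    (hpx : ∀ z, px z = ∏ i, φ (x i) (z i))
    (hpy : ∀ z, py z = ∏ i, φ (y i) (z i)) :
    ∫ z, (py z / px z) ^ lam ∂(Measure.pi (fun i => gaussianReal (x i) ((σ ^ 2).toNNReal))) =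
      Real.exp (lam * (lam - 1) * (∑ i, (x i - y i) ^ 2) / (2 * σ ^ 2)) := by
  have hs : σ ≠ 0 := hσ.ne'
  have hC : (0:ℝ) < (Real.sqrt (2 * Real.pi * σ ^ 2))⁻¹ := by positivity
  have hpos : ∀ μ t, 0 < φ μ t := by
    intro μ t
    rw [hφ]
    positivity
  have hratio : ∀ a b t : ℝ, (φ b t / φ a t) ^ lam =
      Real.exp (lam * (a ^ 2 - b ^ 2) / (2 * σ ^ 2)) *
        Real.exp ((lam * (b - a) / σ ^ 2) * t) := by
    intro a b t
    rw [hφ, hφ, mul_div_mul_left _ _ hC.ne', ← Real.exp_sub, ← Real.exp_mul, ← Real.exp_add]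
    congr 1
    field_simp
    ring
  have hfun : ∀ z, (py z / px z) ^ lam = ∏ i, (φ (y i) (z i) / φ (x i) (z i)) ^ lam := by
    intro z
    rw [hpx, hpy, ← Finset.prod_div_distrib]
    exact (Real.finsetProd_rpow _ _ (fun i _ => (div_pos (hpos _ _) (hpos _ _)).le) _).symm
  have hone : ∀ a b : ℝ, ∫ t, (φ b t / φ a t) ^ lam ∂(gaussianReal a ((σ ^ 2).toNNReal)) =
      Real.exp (lam * (lam - 1) * (a - b) ^ 2 / (2 * σ ^ 2)) := by
    intro a b
    have h := congrFun (mgf_id_gaussianReal (μ := a) (v := (σ ^ 2).toNNReal))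
      (lam * (b - a) / σ ^ 2)
    simp only [mgf, id] at h
    simp_rw [hratio]
    rw [integral_const_mul, h, ← Real.exp_add, Real.coe_toNNReal _ (sq_nonneg σ)]
    congr 1
    field_simp
    ring
  simp_rw [hfun]
  rw [integral_fintype_prod_eq_prod (fun i t => (φ (y i) t / φ (x i) t) ^ lam)]
  simp_rw [hone]
  rw [← Real.exp_sum, Finset.mul_sum, Finset.sum_div]
end
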